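/- Let G be a group (with, in the topological setting, a locally compact Hausdorff topology) and let π : G → U(H) be a (strongly continuous) unitary representation on a complex Hilbert space H. Then π is irreducible if and only if the flip operator F belongs to the double commutant (π⊗π)(G×G)'' ⊆ B(H⊗H), i.e. to the von Neumann algebra generated by the operators π(g)⊗π(h) for g,h ∈ G. -/

import Mathlib

open MeasureTheory Filter Topology

local notation "⟪" x ", " y "⟫" => @inner ℂ _ _ x y

/-- Schur's lemma for self-adjoint operators: a self-adjoint operator commuting with a set of
operators that has no nontrivial closed invariant subspace is a scalar. -/
theorem IsSelfAdjoint.exists_eq_smul_one_of_forall_commute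
    {H : Type*} [NormedAddCommGroup H] [InnerProductSpace ℂ H] [CompleteSpace H]
    {S : Set (H →L[ℂ] H)}
    (hS : ∀ V : Submodule ℂ H, IsClosed (V : Set H) → (∀ u ∈ S, ∀ v ∈ V, u v ∈ V) →
      V = ⊥ ∨ V = ⊤)
    {a : H →L[ℂ] H} (ha : IsSelfAdjoint a) (hc : ∀ u ∈ S, Commute a u) :
    ∃ c : ℂ, a = c • (1 : H →L[ℂ] H) := by
  by_cases hsub : (spectrum ℝ a).Subsingleton
  · obtain ⟨x, hx⟩ : ∃ x : ℝ, (spectrum ℝ a).EqOn id fun _ => x := by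
      rcases hsub.eq_empty_or_singleton with h | ⟨x, h⟩
      · exact ⟨0, by simp [h]⟩
      · exact ⟨x, by simp [h]⟩
    refine ⟨(x : ℂ), ?_⟩
    rw [← cfc_id ℝ a, cfc_congr hx, cfc_const x a]
    ext v
    simp [Algebra.algebraMap_eq_smul_one]
  · exfalso
    obtain ⟨x, hx, y, hy, hxy⟩ := (Set.not_subsingleton_iff.1 hsub).exists_lt
    let m := (x + y) / 2
    let f : ℝ → ℝ := fun t => max (t - m) 0
    let g : ℝ → ℝ := fun t => max (m - t) 0
    have hf : Continuous f := by fun_prop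
    have hg : Continuous g := by fun_prop
    have hzero : ∀ k : ℝ → ℝ, Continuous k → cfc k a = 0 → (spectrum ℝ a).EqOn k fun _ => 0 := by
      intro k hk h
      refine eqOn_of_cfc_eq_cfc (a := a) ?_ hk.continuousOn continuousOn_const ha
      rw [h, cfc_const_zero]
    have hfg : cfc f a * cfc g a = 0 := by
      rw [← cfc_mul f g a hf.continuousOn hg.continuousOn, ← cfc_const_zero ℝ a]
      refine cfc_congr fun t _ => ?_
      rcases le_total t m with h | h
      · simp [f, h]
      · simp [g, h]
    have hker : ∀ u ∈ S, ∀ v ∈ (cfc f a).ker, u v ∈ (cfc f a).ker := by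
      intro u hu v hv
      have h1 := DFunLike.congr_fun ((hc u hu).cfc_real f).eq v
      have hv' : cfc f a v = 0 := by simpa using hv
      simpa [hv'] using h1
    rcases hS (cfc f a).ker (cfc f a).isClosed_ker hker with h | h
    · have hg0 : cfc g a = 0 := by
        ext v
        have : cfc g a v ∈ (cfc f a).ker := by
          simpa using DFunLike.congr_fun hfg v
        rw [h] at this
        simpa using this
      have := hzero g hg hg0 hx
      simp only [g, m, max_eq_right_iff] at this
      linarith
    · have hf0 : cfc f a = 0 := by
        ext v
        have : v ∈ (cfc f a).ker := h ▸ Submodule.mem_top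
        simpa using this
      have := hzero f hf hf0 hy
      simp only [f, m, max_eq_right_iff] at this
      linarith

/-- Schur's lemma for a unitary representation on a complex Hilbert space. -/
theorem exists_eq_smul_one_of_forall_apply_eq {G : Type*} [Group G]
    {H : Type*} [NormedAddCommGroup H] [InnerProductSpace ℂ H] [CompleteSpace H]
    (π : G →* (H ≃ₗᵢ[ℂ] H))
    (hπ : ∀ V : Submodule ℂ H, IsClosed (V : Set H) → (∀ g : G, ∀ v ∈ V, π g v ∈ V) →
      V = ⊥ ∨ V = ⊤)
    {a : H →L[ℂ] H} (ha : ∀ g v, a (π g v) = π g (a v)) :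
    ∃ c : ℂ, a = c • (1 : H →L[ℂ] H) := by
  have hinv : ∀ g x y, ⟪π g x, y⟫ = ⟪x, π g⁻¹ y⟫ := by
    intro g x y
    have h : π g (π g⁻¹ y) = y := by
      change (π g * π g⁻¹) _ = _
      rw [← map_mul]
      simp
    rw [← (π g).inner_map_map x, h]
  let S : Set (H →L[ℂ] H) := Set.range fun g => ((π g).toContinuousLinearEquiv : H →L[ℂ] H)
  have hS : ∀ V : Submodule ℂ H, IsClosed (V : Set H) → (∀ u ∈ S, ∀ v ∈ V, u v ∈ V) →
      V = ⊥ ∨ V = ⊤ := fun V hV h => hπ V hV fun g v hv => h _ ⟨g, rfl⟩ v hv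
  have hc : ∀ u ∈ S, Commute a u := by
    rintro _ ⟨g, rfl⟩
    ext v
    exact ha g v
  have hc' : ∀ u ∈ S, Commute (star a) u := by
    rintro _ ⟨g, rfl⟩
    ext v
    refine ext_inner_right ℂ fun w => ?_
    change ⟪ContinuousLinearMap.adjoint a (π g v), w⟫ = ⟪π g (ContinuousLinearMap.adjoint a v), w⟫
    rw [ContinuousLinearMap.adjoint_inner_left, hinv, hinv, ContinuousLinearMap.adjoint_inner_left,
      ha]
  obtain ⟨c, hre⟩ := (realPart a).2.exists_eq_smul_one_of_forall_commute hS fun u hu => by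
    rw [realPart_apply_coe]
    exact ((hc u hu).add_left (hc' u hu)).smul_left _
  obtain ⟨d, him⟩ := (imaginaryPart a).2.exists_eq_smul_one_of_forall_commute hS fun u hu => by
    rw [imaginaryPart_apply_coe]
    exact (((hc u hu).sub_left (hc' u hu)).smul_left _).smul_left _
  refine ⟨c + Complex.I * d, ?_⟩
  rw [← realPart_add_I_smul_imaginaryPart a, hre, him, smul_smul, add_smul]

/-- A unitary representation `π : G → U(H)` is irreducible if and only if the
flip (braiding) operator `F` on the Hilbert tensor product `H ⊗ H` belongs to the double
commutant of `(π ⊗ π)(G × G)` in `B(H ⊗ H)`.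

The Hilbert tensor product is axiomatized as a complete inner product space `HT` together with a
bilinear map `tensor` whose image spans a dense subspace and which satisfies
`⟪v ⊗ w, v' ⊗ w'⟫ = ⟪v, v'⟫ * ⟪w, w'⟫`; `F` is the unique unitary with `F (v ⊗ w) = w ⊗ v`, and
`Tπ g h` is the operator `π g ⊗ π h` on `HT`. -/
theorem braiding_in_double_commutant_iff_irreducible
    {G : Type*} [Group G]
    {H : Type*} [NormedAddCommGroup H] [InnerProductSpace ℂ H] [CompleteSpace H]
    (π : G →* (H ≃ₗᵢ[ℂ] H))
    {HT : Type*} [NormedAddCommGroup HT] [InnerProductSpace ℂ HT] [CompleteSpace HT]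
    (tensor : H →ₗ[ℂ] H →ₗ[ℂ] HT)
    (htensor_inner : ∀ v w v' w' : H,
      ⟪tensor v w, tensor v' w'⟫ = ⟪v, v'⟫ * ⟪w, w'⟫)
    (htensor_dense :
      Dense (Submodule.span ℂ (Set.range fun p : H × H => tensor p.1 p.2) : Set HT))
    (F : HT ≃ₗᵢ[ℂ] HT)
    (hF : ∀ v w : H, F (tensor v w) = tensor w v)
    (Tπ : G → G → (HT →L[ℂ] HT))
    (hTπ : ∀ (g h : G) (v w : H), Tπ g h (tensor v w) = tensor (π g v) (π h w)) :
    (∀ V : Submodule ℂ H, IsClosed (V : Set H) → (∀ g : G, ∀ v ∈ V, π g v ∈ V) →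
        V = ⊥ ∨ V = ⊤) ↔
      F.toLinearIsometry.toContinuousLinearMap ∈
        Set.centralizer (Set.centralizer {T : HT →L[ℂ] HT | ∃ g h : G, T = Tπ g h}) := by
  have norm_tensor : ∀ v w, ‖tensor v w‖ = ‖v‖ * ‖w‖ := by
    intro v w
    have h := htensor_inner v w v w
    simp only [inner_self_eq_norm_sq_to_K] at h
    have h2 : ‖tensor v w‖ ^ 2 = (‖v‖ * ‖w‖) ^ 2 := by
      rw [mul_pow]
      exact_mod_cast h
    exact (pow_left_inj₀ (norm_nonneg _) (by positivity) two_ne_zero).1 h2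
  have clm_ext : ∀ f g : HT →L[ℂ] HT,
      (∀ v w, f (tensor v w) = g (tensor v w)) → f = g := by
    intro f g h
    refine ContinuousLinearMap.ext_on htensor_dense ?_
    rintro _ ⟨p, rfl⟩
    exact h _ _
  have vec_ext : ∀ x y : HT, (∀ v w, ⟪tensor v w, x⟫ = ⟪tensor v w, y⟫) → x = y := by
    intro x y h
    refine htensor_dense.eq_of_inner_right (𝕜 := ℂ) ?_
    intro z hz
    induction hz using Submodule.span_induction with
    | mem z hz =>
      obtain ⟨p, rfl⟩ := hz
      exact h _ _
    | zero => simp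
    | add a b _ _ ha hb => simp [inner_add_left, ha, hb]
    | smul c a _ ha => simp [inner_smul_left, ha]
  have hinv : ∀ g x y, ⟪x, π g y⟫ = ⟪π g⁻¹ x, y⟫ := by
    intro g x y
    have h : π g (π g⁻¹ x) = x := by
      change (π g * π g⁻¹) _ = _
      rw [← map_mul]
      simp
    rw [← (π g).inner_map_map (π g⁻¹ x), h]
  have hadj : ∀ g h x y, ⟪x, Tπ g h y⟫ = ⟪Tπ g⁻¹ h⁻¹ x, y⟫ := by
    intro g h x y
    rw [← ContinuousLinearMap.adjoint_inner_left]
    congr 1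
    revert x
    refine DFunLike.congr_fun (clm_ext _ _ fun v w => vec_ext _ _ fun v' w' => ?_)
    rw [ContinuousLinearMap.adjoint_inner_right, hTπ, hTπ, htensor_inner, htensor_inner,
      hinv g⁻¹, hinv h⁻¹, inv_inv, inv_inv]
  constructor
  · intro hirr T hT
    replace hT : ∀ g h x, T (Tπ g h x) = Tπ g h (T x) := fun g h x =>
      (DFunLike.congr_fun (hT (Tπ g h) ⟨g, h, rfl⟩) x).symm
    obtain ⟨d, hd⟩ : ∃ d : ℂ, T = d • (1 : HT →L[ℂ] HT) := by
      let L : H → H →L[ℂ] HT := fun w => (tensor.flip w).mkContinuous ‖w‖ fun v => by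
        simp [norm_tensor, mul_comm]
      let R : H → H →L[ℂ] HT := fun v => (tensor v).mkContinuous ‖v‖ fun w => by
        simp [norm_tensor]
      have hL : ∀ w' w, ∃ c : ℂ, ∀ v' v, ⟪tensor v' w', T (tensor v w)⟫ = c * ⟪v', v⟫ := by
        intro w' w
        have key : ∀ v' v, ⟪v', (ContinuousLinearMap.adjoint (L w') ∘L T ∘L L w) v⟫ =
            ⟪tensor v' w', T (tensor v w)⟫ := fun v' v => by
          rw [ContinuousLinearMap.comp_apply, ContinuousLinearMap.adjoint_inner_right]
          rfl
        obtain ⟨c, hc⟩ := exists_eq_smul_one_of_forall_apply_eq π hirr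
          (a := ContinuousLinearMap.adjoint (L w') ∘L T ∘L L w) fun g v => by
            refine ext_inner_left ℂ fun v' => ?_
            have h1 := hTπ g 1 v w
            have h2 := hTπ g⁻¹ 1⁻¹ v' w'
            simp only [map_one, inv_one, LinearIsometryEquiv.coe_one, id_eq] at h1 h2
            rw [key, hinv, key, ← h1, hT, hadj, inv_one, h2]
        refine ⟨c, fun v' v => ?_⟩
        rw [← key, hc]
        simp
      have hR : ∀ v' v, ∃ c : ℂ, ∀ w' w, ⟪tensor v' w', T (tensor v w)⟫ = c * ⟪w', w⟫ := by
        intro v' v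
        have key : ∀ w' w, ⟪w', (ContinuousLinearMap.adjoint (R v') ∘L T ∘L R v) w⟫ =
            ⟪tensor v' w', T (tensor v w)⟫ := fun w' w => by
          rw [ContinuousLinearMap.comp_apply, ContinuousLinearMap.adjoint_inner_right]
          rfl
        obtain ⟨c, hc⟩ := exists_eq_smul_one_of_forall_apply_eq π hirr
          (a := ContinuousLinearMap.adjoint (R v') ∘L T ∘L R v) fun g w => by
            refine ext_inner_left ℂ fun w' => ?_
            have h1 := hTπ 1 g v w
            have h2 := hTπ 1⁻¹ g⁻¹ v' w'
            simp only [map_one, inv_one, LinearIsometryEquiv.coe_one, id_eq] at h1 h2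
            rw [key, hinv, key, ← h1, hT, hadj, inv_one, h2]
        refine ⟨c, fun w' w => ?_⟩
        rw [← key, hc]
        simp
      rcases subsingleton_or_nontrivial H with hH | hH
      · refine ⟨0, clm_ext _ _ fun v w => ?_⟩
        simp [Subsingleton.elim v 0]
      · obtain ⟨e, he⟩ := exists_norm_eq H zero_le_one
        have hee : ⟪e, e⟫ = 1 := by simp [inner_self_eq_norm_sq_to_K, he]
        obtain ⟨d, hd⟩ := hR e e
        refine ⟨d, clm_ext _ _ fun v w => vec_ext _ _ fun v' w' => ?_⟩
        obtain ⟨c, hc⟩ := hL w' w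
        have h1 := hc e e
        rw [hd, hee, mul_one] at h1
        rw [hc, ← h1]
        simp [htensor_inner]
        ring
    ext x
    simp [hd]
  · intro hFc V hVc hV
    have : CompleteSpace V := hVc.completeSpace_coe
    let S : Submodule ℂ HT := Submodule.span ℂ {x | ∃ v ∈ V, ∃ w, x = tensor v w}
    have memK : ∀ x, x ∈ Sᗮ ↔ ∀ v ∈ V, ∀ w, ⟪tensor v w, x⟫ = 0 := by
      intro x
      refine ⟨fun h v hv w => h _ (Submodule.subset_span ⟨v, hv, w, rfl⟩), fun h z hz => ?_⟩
      induction hz using Submodule.span_induction with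
      | mem z hz =>
        obtain ⟨v, hv, w, rfl⟩ := hz
        exact h v hv w
      | zero => simp
      | add a b _ _ ha hb => simp [inner_add_left, ha, hb]
      | smul c a _ ha => simp [inner_smul_left, ha]
    have hK : ∀ g h, ∀ x ∈ Sᗮ, Tπ g h x ∈ Sᗮ := by
      intro g h x hx
      rw [memK] at hx ⊢
      intro v hv w
      rw [hadj, hTπ]
      exact hx _ (hV _ _ hv) _
    have hK' : ∀ g h, ∀ x ∈ Sᗮᗮ, Tπ g h x ∈ Sᗮᗮ := by
      intro g h x hx z hz
      rw [hadj]
      exact hx _ (hK _ _ _ hz)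
    have hQ : Sᗮ.starProjection ∈
        Set.centralizer {T : HT →L[ℂ] HT | ∃ g h : G, T = Tπ g h} := by
      rintro _ ⟨g, h, rfl⟩
      ext x
      refine (Submodule.eq_starProjection_of_mem_orthogonal
        (hK g h _ (Sᗮ.starProjection_apply_mem x)) ?_).symm
      change Tπ g h x - Tπ g h (Sᗮ.starProjection x) ∈ Sᗮᗮ
      rw [← map_sub]
      exact hK' g h _ (Submodule.sub_starProjection_mem_orthogonal x)
    have hFK : ∀ x ∈ Sᗮ, F x ∈ Sᗮ := by
      intro x hx
      have h := DFunLike.congr_fun (hFc _ hQ) x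
      change Sᗮ.starProjection (F x) = F (Sᗮ.starProjection x) at h
      rw [Submodule.starProjection_eq_self_iff.2 hx] at h
      exact Submodule.starProjection_eq_self_iff.1 h
    have hzero : ∀ v ∈ V, ∀ w ∈ Vᗮ, v = 0 ∨ w = 0 := by
      intro v hv w hw
      have h1 : tensor w v ∈ Sᗮ := by
        rw [memK]
        intro v' hv' w'
        rw [htensor_inner, hw v' hv', zero_mul]
      have h2 := hFK _ h1
      rw [hF, memK] at h2
      have h3 := inner_self_eq_zero.1 (h2 v hv w)
      have h4 := norm_tensor v w
      simpa [h3] using h4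
    by_cases hbot : V = ⊥
    · exact Or.inl hbot
    · obtain ⟨v, hv, hv0⟩ := Submodule.exists_mem_ne_zero_of_ne_bot hbot
      refine Or.inr ((Submodule.orthogonal_eq_bot_iff).1 ((Submodule.eq_bot_iff _).2 fun w hw => ?_))
      exact (hzero v hv w hw).resolve_left hv0
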